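/- arXiv:1404.2963 — 2 statements merged into one kernel-verified Lean document; each statement's English description precedes it below -/
import Mathlib

section
/- Let ω be an integrable homogeneous 1-form (ω ∧ dω = 0). For homogeneous forms τ of odd rank r, define ω△τ := ω ∧ dτ + κ(r)·dω ∧ τ where κ(r) = (r+1)/2. Then for any homogeneous (2s−1)-form τ, one has ω△(ω△τ) = (2(κ+1))·ω ∧ dω ∧ dτ + (κ(κ+1))·dω ∧ dω ∧ τ where κ = κ(2s−1) = s; in particular, if ω ∧ dω = 0 and dω ∧ dω = 0 then ω△(ω△τ) = 0. -/
open MvPolynomial Finset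

noncomputable section

/-- An `r`-form on `ℂ^m` with polynomial coefficients, represented by its
(intendedly alternating) coefficient function `(i₁,…,i_r) ↦ τ_{i₁…i_r}`. -/
abbrev Form (m r : ℕ) : Type := (Fin r → Fin m) → MvPolynomial (Fin m) ℂ

/-- The coefficient function is alternating. -/
def IsAlt {m r : ℕ} (τ : Form m r) : Prop :=
  ∀ (f : Fin r → Fin m) (σ : Equiv.Perm (Fin r)),
    τ (f ∘ σ) = ((Equiv.Perm.sign σ : ℤˣ) : ℤ) • τ f

/-- `τ` is a homogeneous `r`-form of total degree `p` (each `xᵢ` and each `dxᵢ`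
has degree `1`, so the polynomial coefficients are homogeneous of degree `p - r`). -/
def IsHomog {m : ℕ} (r p : ℕ) (τ : Form m r) : Prop :=
  ∀ f, (τ f).IsHomogeneous (p - r)

/-- Wedge product of forms (antisymmetrized product). -/
def wedge {m r s : ℕ} (τ : Form m r) (σ : Form m s) : Form m (r + s) :=
  fun f => (((r.factorial * s.factorial : ℕ) : ℂ))⁻¹ •
    ∑ π : Equiv.Perm (Fin (r + s)),
      ((Equiv.Perm.sign π : ℤˣ) : ℤ) •
        (τ (fun i => f (π (Fin.castAdd s i))) * σ (fun j => f (π (Fin.natAdd r j))))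

/-- Exterior derivative. -/
def extd {m r : ℕ} (τ : Form m r) : Form m (r + 1) :=
  fun f => ∑ i : Fin (r + 1),
    (-1 : ℤ) ^ (i : ℕ) • MvPolynomial.pderiv (f i) (τ (f ∘ i.succAbove))

/-- Contraction (interior product) with the radial vector field `R = Σ xᵢ ∂/∂xᵢ`. -/
def ctr {m r : ℕ} (τ : Form m (r + 1)) : Form m r :=
  fun f => ∑ j : Fin m, MvPolynomial.X j * τ (Fin.cons j f)

/-- Contraction with a polynomial vector field `X = Σ Xᵢ ∂/∂xᵢ`. -/
def ctrX {m r : ℕ} (X : Fin m → MvPolynomial (Fin m) ℂ) (τ : Form m (r + 1)) : Form m r :=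
  fun f => ∑ j : Fin m, X j * τ (Fin.cons j f)

/-- A polynomial regarded as a `0`-form. -/
def const {m : ℕ} (h : MvPolynomial (Fin m) ℂ) : Form m 0 := fun _ => h

/-- Reindexing a form along an equality of ranks. -/
def castF {m r s : ℕ} (h : r = s) (τ : Form m r) : Form m s :=
  fun f => τ (f ∘ Fin.cast h)

/-- `d (i_R τ)`, defined for forms of any rank (it is `0` on `0`-forms). -/
def dIR {m : ℕ} : {r : ℕ} → Form m r → Form m r
  | 0, _ => 0
  | _ + 1, τ => extd (ctr τ)

/-- `i_R (d τ)`, defined for forms of any rank. -/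
def iRd {m r : ℕ} (τ : Form m r) : Form m r := ctr (extd τ)

/-- The operator `ω △ τ := ω ∧ dτ + κ · dω ∧ τ`. -/
def triangle {m : ℕ} (ω : Form m 1) (κ : ℂ) {r : ℕ} (τ : Form m r) : Form m (r + 2) :=
  castF (by omega) (wedge ω (extd τ)) + κ • castF (by omega) (wedge (extd ω) τ)

end

namespace Form

/-- The exterior algebra of the free module on the `dxᵢ`. -/
abbrev ExtAlg (m : ℕ) : Type :=
  ExteriorAlgebra (MvPolynomial (Fin m) ℂ) (Fin m → MvPolynomial (Fin m) ℂ)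

/-- The basis vector `dxₐ` of the module of `1`-forms. -/
noncomputable abbrev dx {m : ℕ} (a : Fin m) : Fin m → MvPolynomial (Fin m) ℂ := Pi.single a 1

/-- The generator `dxₐ` of the exterior algebra. -/
noncomputable def gen {m : ℕ} (a : Fin m) : ExtAlg m :=
  ExteriorAlgebra.ι (MvPolynomial (Fin m) ℂ) (dx a)

/-- The product `dx_{f 0} ∧ ⋯ ∧ dx_{f (r-1)}`. -/
noncomputable def monom {m r : ℕ} (f : Fin r → Fin m) : ExtAlg m :=
  ExteriorAlgebra.ιMulti (MvPolynomial (Fin m) ℂ) r (fun i => dx (f i))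

/-- The element `(1/r!) ∑ τ_f dx_f` of the exterior algebra represented by `τ`. -/
noncomputable def toExt {m r : ℕ} (τ : Form m r) : ExtAlg m :=
  ∑ f : Fin r → Fin m, (((r.factorial : ℂ))⁻¹ • τ f) • monom f

/-- Coefficientwise partial derivative. -/
noncomputable def pd {m r : ℕ} (a : Fin m) (τ : Form m r) : Form m r :=
  fun f => pderiv a (τ f)

/-- The functional on the exterior algebra reading off the coefficient of `dx_f`. -/
noncomputable def coeffExt {m r : ℕ} (f : Fin r → Fin m) :
    ExtAlg m →ₗ[MvPolynomial (Fin m) ℂ] MvPolynomial (Fin m) ℂ :=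
  ExteriorAlgebra.liftAlternating
    (Pi.single r (Matrix.detRowAlternating.compLinearMap
      (LinearMap.funLeft (MvPolynomial (Fin m) ℂ) (MvPolynomial (Fin m) ℂ) f)))

variable {m r s : ℕ}

/-! ### Monomials -/

theorem monom_comp_perm (f : Fin r → Fin m) (π : Equiv.Perm (Fin r)) :
    monom (f ∘ π) = ((Equiv.Perm.sign π : ℤˣ) : ℤ) • monom f := by
  have := (ExteriorAlgebra.ιMulti (MvPolynomial (Fin m) ℂ) r).map_perm
    (fun i => dx (f i)) π
  rw [Units.smul_def] at this
  exact this

theorem monom_add (f : Fin (r + s) → Fin m) :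
    monom f = monom (fun i => f (Fin.castAdd s i)) * monom (fun j => f (Fin.natAdd r j)) := by
  simp only [monom, ExteriorAlgebra.ιMulti_apply]
  rw [← List.prod_append, List.ofFn_add]
  rfl

theorem monom_insertNth (i : Fin (r + 1)) (a : Fin m) (g : Fin r → Fin m) :
    monom (i.insertNth a g : Fin (r + 1) → Fin m) = (-1 : ℤ) ^ (i : ℕ) • (gen a * monom g) := by
  have h := (ExteriorAlgebra.ιMulti (MvPolynomial (Fin m) ℂ) (r + 1)).map_insertNth i
    (dx a) (fun j => dx (g j))
  have e : (fun j => dx ((i.insertNth a g : Fin (r + 1) → Fin m) j)) =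
      (i.insertNth (dx a) (fun j => dx (g j)) :
        Fin (r + 1) → Fin m → MvPolynomial (Fin m) ℂ) := by
    funext j
    refine Fin.succAboveCases i ?_ (fun k => ?_) j <;> simp
  rw [monom, e, h, ExteriorAlgebra.ιMulti_succ_apply]
  simp [gen, monom, Matrix.vecTail, Function.comp_def]

theorem gen_mul_gen_swap (a b : Fin m) : gen a * gen b = -(gen b * gen a) :=
  eq_neg_of_add_eq_zero_left (ExteriorAlgebra.ι_add_mul_swap _ _)

theorem monom_mul_gen (f : Fin r → Fin m) (a : Fin m) :
    monom f * gen a = (-1 : ℤ) ^ r • (gen a * monom f) := by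
  induction r with
  | zero => simp [monom]
  | succ r ih =>
    have h : monom f = gen (f 0) * monom (fun i => f i.succ) := by
      rw [monom, ExteriorAlgebra.ιMulti_succ_apply]; rfl
    rw [h, mul_assoc, ih, mul_smul_comm, ← mul_assoc, gen_mul_gen_swap, pow_succ]
    simp [mul_assoc]

theorem coeffExt_monom (f g : Fin r → Fin m) :
    coeffExt f (monom g) =
      ∑ π : Equiv.Perm (Fin r), ((Equiv.Perm.sign π : ℤˣ) : ℤ) • if g ∘ π = f then 1 else 0 := by
  rw [coeffExt, monom, ExteriorAlgebra.liftAlternating_apply_ιMulti, Pi.single_eq_same,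
    AlternatingMap.compLinearMap_apply]
  refine (Matrix.det_apply (Matrix.of fun i j =>
    LinearMap.funLeft (MvPolynomial (Fin m) ℂ) (MvPolynomial (Fin m) ℂ) f (dx (g i)) j)).trans ?_
  refine Finset.sum_congr rfl fun π _ => ?_
  rw [Units.smul_def]
  congr 1
  simp only [Matrix.of_apply, LinearMap.funLeft_apply, Pi.single_apply, Finset.prod_ite_zero, funext_iff,
    Function.comp_apply, Finset.mem_univ, true_imp_iff, Finset.prod_const_one, eq_comm]

/-! ### The map to the exterior algebra -/

theorem coeffExt_toExt {τ : Form m r} (hτ : IsAlt τ) (f : Fin r → Fin m) :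
    coeffExt f (toExt τ) = τ f := by
  have hsum : ∀ π : Equiv.Perm (Fin r),
      ∑ g : Fin r → Fin m, ((r.factorial : ℂ)⁻¹ • τ g) *
        (((Equiv.Perm.sign π : ℤˣ) : ℤ) • if g ∘ π = f then 1 else 0) =
      (r.factorial : ℂ)⁻¹ • τ f := by
    intro π
    rw [Finset.sum_eq_single (f ∘ π.symm)]
    · have : (f ∘ π.symm) ∘ π = f := by ext; simp
      rw [if_pos this, hτ, Equiv.Perm.sign_symm]
      rcases Int.units_eq_one_or (Equiv.Perm.sign π) with h | h <;> simp [h]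
    · intro g _ hg
      rw [if_neg, smul_zero, mul_zero]
      rintro rfl
      exact hg (by ext; simp)
    · simp
  simp only [toExt, map_sum, map_smul, coeffExt_monom, smul_eq_mul, Finset.mul_sum]
  rw [Finset.sum_comm]
  simp only [hsum, Finset.sum_const, Finset.card_univ, Fintype.card_perm, Fintype.card_fin]
  rw [← Nat.cast_smul_eq_nsmul ℂ, smul_smul,
    mul_inv_cancel₀ (Nat.cast_ne_zero.2 r.factorial_ne_zero), one_smul]

theorem eq_of_toExt_eq {τ σ : Form m r} (hτ : IsAlt τ) (hσ : IsAlt σ)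
    (h : toExt τ = toExt σ) : τ = σ := by
  funext f
  rw [← coeffExt_toExt hτ, h, coeffExt_toExt hσ]

theorem toExt_add (τ σ : Form m r) : toExt (τ + σ) = toExt τ + toExt σ := by
  simp [toExt, add_smul, Finset.sum_add_distrib]

theorem toExt_smul (c : ℂ) (τ : Form m r) :
    toExt (c • τ) = (C c : MvPolynomial (Fin m) ℂ) • toExt τ := by
  simp only [toExt, Finset.smul_sum, Pi.smul_apply]
  refine Finset.sum_congr rfl fun f _ => ?_
  rw [smul_smul (C c), C_mul', smul_comm c]

theorem toExt_zero : toExt (0 : Form m r) = 0 := by simp [toExt]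

theorem toExt_castF (h : r = s) (τ : Form m r) : toExt (castF h τ) = toExt τ := by
  subst h; rfl

theorem toExt_wedge (τ : Form m r) (σ : Form m s) :
    toExt (wedge τ σ) = toExt τ * toExt σ := by
  set T : (Fin (r + s) → Fin m) → MvPolynomial (Fin m) ℂ := fun f =>
    τ (fun i => f (Fin.castAdd s i)) * σ (fun j => f (Fin.natAdd r j))
  have hperm : ∀ π : Equiv.Perm (Fin (r + s)),
      ∑ f : Fin (r + s) → Fin m, (((Equiv.Perm.sign π : ℤˣ) : ℤ) • T (f ∘ π)) • monom f =
        ∑ f, T f • monom f := by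
    intro π
    refine Fintype.sum_equiv (Equiv.arrowCongr π.symm (Equiv.refl _)) _ _ fun f => ?_
    have : (Equiv.arrowCongr π.symm (Equiv.refl (Fin m))) f = f ∘ π := by ext; simp
    rw [this, monom_comp_perm, smul_assoc, smul_comm]
  have hl : toExt (wedge τ σ) =
      (C ((r.factorial : ℂ)⁻¹ * (s.factorial : ℂ)⁻¹) : MvPolynomial (Fin m) ℂ) •
        ∑ f, T f • monom f := by
    have h0 : toExt (wedge τ σ) =
        (C (((r + s).factorial : ℂ)⁻¹ * ((r.factorial : ℂ)⁻¹ * (s.factorial : ℂ)⁻¹)) :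
          MvPolynomial (Fin m) ℂ) • ∑ π : Equiv.Perm (Fin (r + s)),
          ∑ f, (((Equiv.Perm.sign π : ℤˣ) : ℤ) • T (f ∘ π)) • monom f := by
      rw [Finset.sum_comm, Finset.smul_sum, toExt]
      refine Finset.sum_congr rfl fun f _ => ?_
      rw [← Finset.sum_smul, smul_smul, C_mul', wedge, smul_smul, Nat.cast_mul, mul_inv]
      rfl
    rw [h0]
    simp only [hperm, Finset.sum_const, Finset.card_univ, Fintype.card_perm, Fintype.card_fin]
    rw [← Nat.cast_smul_eq_nsmul (MvPolynomial (Fin m) ℂ), smul_smul]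
    congr 1
    rw [← map_natCast (C : ℂ →+* MvPolynomial (Fin m) ℂ), ← C_mul, mul_right_comm,
      inv_mul_cancel₀ (Nat.cast_ne_zero.2 (r + s).factorial_ne_zero), one_mul]
  rw [hl, toExt, toExt, Finset.sum_mul_sum, ← Fintype.sum_prod_type', Finset.smul_sum]
  refine Fintype.sum_equiv (Fin.appendEquiv r s).symm _ _ fun f => ?_
  rw [smul_mul_smul_comm, monom_add f, smul_smul]
  congr 1
  rw [C_mul', smul_mul_smul_comm]
  rfl

theorem toExt_extd (τ : Form m r) : toExt (extd τ) = ∑ a, gen a * toExt (pd a τ) := by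
  have hi : ∀ i : Fin (r + 1),
      ∑ f : Fin (r + 1) → Fin m,
        ((-1 : ℤ) ^ (i : ℕ) • pderiv (f i) (τ (f ∘ i.succAbove))) • monom f =
      ∑ a, ∑ g, pderiv a (τ g) • (gen a * monom g) := by
    intro i
    rw [← Fintype.sum_prod_type']
    refine (Fintype.sum_equiv (Fin.insertNthEquiv (fun _ => Fin m) i) _ _ fun p => ?_).symm
    have h1 : (Fin.insertNthEquiv (fun _ => Fin m) i p : Fin (r + 1) → Fin m) =
      i.insertNth p.1 p.2 := rfl
    have h2 : (i.insertNth p.1 p.2 : Fin (r + 1) → Fin m) ∘ i.succAbove = p.2 := by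
      ext; simp
    rw [h1, h2, monom_insertNth, Fin.insertNth_apply_same, smul_assoc, smul_comm, smul_smul,
      ← pow_add, Even.neg_one_pow ⟨_, rfl⟩, one_smul]
  have h0 : toExt (extd τ) = (C (((r + 1).factorial : ℂ)⁻¹) : MvPolynomial (Fin m) ℂ) •
      ∑ i : Fin (r + 1), ∑ f : Fin (r + 1) → Fin m,
        ((-1 : ℤ) ^ (i : ℕ) • pderiv (f i) (τ (f ∘ i.succAbove))) • monom f := by
    rw [Finset.sum_comm, Finset.smul_sum, toExt]
    refine Finset.sum_congr rfl fun f _ => ?_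
    rw [← Finset.sum_smul, smul_smul, C_mul', extd]
  rw [h0]
  simp only [hi, Finset.sum_const, Finset.card_univ, Fintype.card_fin]
  rw [← Nat.cast_smul_eq_nsmul (MvPolynomial (Fin m) ℂ), smul_smul,
    ← map_natCast (C : ℂ →+* MvPolynomial (Fin m) ℂ), ← C_mul]
  have hc : ((r + 1).factorial : ℂ)⁻¹ * ((r + 1 : ℕ) : ℂ) = (r.factorial : ℂ)⁻¹ := by
    rw [Nat.factorial_succ, Nat.cast_mul, mul_inv, mul_right_comm,
      inv_mul_cancel₀ (Nat.cast_ne_zero.2 r.succ_ne_zero), one_mul]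
  rw [hc, Finset.smul_sum]
  refine Finset.sum_congr rfl fun a _ => ?_
  rw [toExt, Finset.mul_sum, Finset.smul_sum]
  refine Finset.sum_congr rfl fun g _ => ?_
  rw [smul_smul, C_mul', mul_smul_comm]
  rfl

theorem toExt_mul_gen (τ : Form m r) (a : Fin m) :
    toExt τ * gen a = (-1 : ℤ) ^ r • (gen a * toExt τ) := by
  simp only [toExt, Finset.sum_mul, Finset.mul_sum, Finset.smul_sum]
  refine Finset.sum_congr rfl fun f _ => ?_
  rw [smul_mul_assoc, monom_mul_gen, mul_smul_comm, smul_comm]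

/-! ### Differential calculus -/

theorem pd_wedge (a : Fin m) (τ : Form m r) (σ : Form m s) :
    pd a (wedge τ σ) = wedge (pd a τ) σ + wedge τ (pd a σ) := by
  funext f
  simp only [pd, wedge, Pi.add_apply, Derivation.map_smul, map_sum, map_zsmul, pderiv_mul, smul_add,
    Finset.sum_add_distrib]

theorem pderiv_comm (a b : Fin m) (p : MvPolynomial (Fin m) ℂ) :
    pderiv a (pderiv b p) = pderiv b (pderiv a p) := by
  have h : ⁅pderiv (R := ℂ) a, pderiv (R := ℂ) b⁆ = 0 := by
    refine MvPolynomial.derivation_ext fun i => ?_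
    simp [Derivation.commutator_apply, pderiv_X, Pi.single_apply, apply_ite]
  have := congrArg (fun D => D p) h
  simpa [Derivation.commutator_apply, sub_eq_zero] using this

theorem pd_extd (a : Fin m) (τ : Form m r) : pd a (extd τ) = extd (pd a τ) := by
  funext f
  simp only [pd, extd, map_sum, map_zsmul, pderiv_comm a]

theorem toExt_extd_castF (h : r = s) (τ : Form m r) :
    toExt (extd (castF h τ)) = toExt (extd τ) := by
  subst h; rfl

theorem extd_add (τ σ : Form m r) : extd (τ + σ) = extd τ + extd σ := by
  funext f
  simp [extd, Finset.sum_add_distrib]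

theorem extd_smul (c : ℂ) (τ : Form m r) : extd (c • τ) = c • extd τ := by
  funext f
  simp only [extd, Pi.smul_apply, Derivation.map_smul, Finset.smul_sum]
  exact Finset.sum_congr rfl fun i _ => smul_comm _ _ _

theorem toExt_extd_wedge (τ : Form m r) (σ : Form m s) :
    toExt (extd (wedge τ σ)) =
      toExt (extd τ) * toExt σ + (-1 : ℤ) ^ r • (toExt τ * toExt (extd σ)) := by
  simp only [toExt_extd, pd_wedge, toExt_add, toExt_wedge, mul_add, Finset.sum_add_distrib,
    Finset.sum_mul, Finset.mul_sum, Finset.smul_sum]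
  congr 1
  · exact Finset.sum_congr rfl fun a _ => (mul_assoc _ _ _).symm
  · refine Finset.sum_congr rfl fun a _ => ?_
    rw [← mul_assoc (toExt τ), toExt_mul_gen, smul_mul_assoc, smul_smul, ← pow_add,
      Even.neg_one_pow ⟨_, rfl⟩, one_smul, mul_assoc]

theorem toExt_extd_extd (τ : Form m r) : toExt (extd (extd τ)) = 0 := by
  have h : toExt (extd (extd τ)) = -toExt (extd (extd τ)) := by
    simp only [toExt_extd, pd_extd, Finset.mul_sum]
    conv_lhs => rw [Finset.sum_comm]
    simp only [← Finset.sum_neg_distrib]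
    refine Finset.sum_congr rfl fun a _ => Finset.sum_congr rfl fun b _ => ?_
    have hc : pd a (pd b τ) = pd b (pd a τ) := funext fun f => pderiv_comm a b _
    rw [← mul_assoc, ← mul_assoc, gen_mul_gen_swap b a, neg_mul, hc]
  have h2 : (2 : MvPolynomial (Fin m) ℂ) • toExt (extd (extd τ)) = 0 := by
    rw [two_smul]
    exact eq_neg_iff_add_eq_zero.1 h
  have h3 := congrArg (fun x => (C (2⁻¹ : ℂ) : MvPolynomial (Fin m) ℂ) • x) h2
  have hC : (C (2⁻¹ : ℂ) : MvPolynomial (Fin m) ℂ) * 2 = 1 := by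
    rw [← map_ofNat (C : ℂ →+* MvPolynomial (Fin m) ℂ) 2, ← C_mul]
    norm_num
  simpa [smul_smul, hC] using h3

/-- A `1`-form commutes with every form of even rank. -/
theorem toExt_comm_of_even (hr : Even r) (τ : Form m r) (α : Form m 1) :
    toExt τ * toExt α = toExt α * toExt τ := by
  have h : ∀ f : Fin 1 → Fin m, monom f = gen (f 0) := fun f => by
    simp [monom, gen, ExteriorAlgebra.ιMulti_apply]
  rw [toExt.eq_1 α, Finset.mul_sum, Finset.sum_mul]
  refine Finset.sum_congr rfl fun f _ => ?_
  rw [mul_smul_comm, smul_mul_assoc, h, toExt_mul_gen, hr.neg_one_pow, one_smul]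

/-! ### Alternating forms -/

theorem isAlt_wedge (τ : Form m r) (σ : Form m s) : IsAlt (wedge τ σ) := by
  intro f ρ
  simp only [wedge]
  rw [smul_comm (((Equiv.Perm.sign ρ : ℤˣ) : ℤ)) (((r.factorial * s.factorial : ℕ) : ℂ))⁻¹]
  congr 1
  rw [Finset.smul_sum]
  refine Fintype.sum_equiv (Equiv.mulLeft ρ) _ _ fun π => ?_
  rw [Equiv.coe_mulLeft, smul_smul, Equiv.Perm.sign_mul, ← Units.val_mul, ← mul_assoc,
    Int.units_mul_self, one_mul]
  rfl

theorem isAlt_add {τ σ : Form m r} (hτ : IsAlt τ) (hσ : IsAlt σ) : IsAlt (τ + σ) := by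
  intro f ρ
  rw [Pi.add_apply, Pi.add_apply, hτ, hσ, smul_add]

theorem isAlt_smul (c : ℂ) {τ : Form m r} (hτ : IsAlt τ) : IsAlt (c • τ) := by
  intro f ρ
  rw [Pi.smul_apply, Pi.smul_apply, hτ, smul_comm]

theorem isAlt_castF (h : r = s) {τ : Form m r} (hτ : IsAlt τ) : IsAlt (castF h τ) := by
  subst h; exact hτ

theorem isAlt_triangle (ω : Form m 1) (κ : ℂ) (τ : Form m r) : IsAlt (triangle ω κ τ) :=
  isAlt_add (isAlt_castF _ (isAlt_wedge _ _)) (isAlt_smul _ (isAlt_castF _ (isAlt_wedge _ _)))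

/-! ### The operator `△` -/

theorem toExt_triangle (ω : Form m 1) (κ : ℂ) (τ : Form m r) :
    toExt (triangle ω κ τ) = toExt ω * toExt (extd τ) +
      (C κ : MvPolynomial (Fin m) ℂ) • (toExt (extd ω) * toExt τ) := by
  simp only [triangle, toExt_add, toExt_smul, toExt_castF, toExt_wedge]

theorem toExt_extd_triangle (ω : Form m 1) (κ : ℂ) (τ : Form m r) :
    toExt (extd (triangle ω κ τ)) =
      (C (κ + 1) : MvPolynomial (Fin m) ℂ) • (toExt (extd ω) * toExt (extd τ)) := by
  simp only [triangle, extd_add, extd_smul, toExt_add, toExt_smul, toExt_extd_castF,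
    toExt_extd_wedge, toExt_extd_extd, C_add, C_1, add_smul, one_smul]
  simp [add_comm]

theorem toExt_triangle_triangle (ω : Form m 1) (κ : ℂ) (τ : Form m r) :
    toExt (triangle ω (κ + 1) (triangle ω κ τ)) =
      (C (2 * (κ + 1)) : MvPolynomial (Fin m) ℂ) •
        (toExt ω * (toExt (extd ω) * toExt (extd τ))) +
      (C (κ * (κ + 1)) : MvPolynomial (Fin m) ℂ) •
        (toExt (extd ω) * (toExt (extd ω) * toExt τ)) := by
  have hcomm := toExt_comm_of_even even_two (extd ω) ω
  rw [toExt_triangle, toExt_extd_triangle, toExt_triangle, mul_add, smul_add, mul_smul_comm,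
    mul_smul_comm, smul_smul, ← mul_assoc (toExt (extd ω)) (toExt ω), hcomm, mul_assoc, two_mul,
    @C_add _ _ (κ + 1) (κ + 1), add_smul, ← C_mul, mul_comm κ, add_assoc]

end Form

/-- the expansion of `ω△(ω△τ)` for the extended operator
`ω△τ = ω∧dτ + κ(r)·dω∧τ`, `κ(r) = (r+1)/2`, and its vanishing when
`ω∧dω = 0` and `dω∧dω = 0`. -/
theorem triangle_squared {m r : ℕ} (hr : Odd r) (ω : Form m 1)
    (hω : IsAlt ω) (hint : wedge ω (extd ω) = 0)
    (τ : Form m r) (hτ : IsAlt τ) (κ : ℂ) (hκ : κ = ((r : ℂ) + 1) / 2) :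
    triangle ω (κ + 1) (triangle ω κ τ) =
      castF (by omega) ((2 * (κ + 1)) • wedge ω (wedge (extd ω) (extd τ))) +
      castF (by omega) ((κ * (κ + 1)) • wedge (extd ω) (wedge (extd ω) τ)) ∧
    (wedge (extd ω) (extd ω) = 0 → triangle ω (κ + 1) (triangle ω κ τ) = 0) := by
  have hsq : triangle ω (κ + 1) (triangle ω κ τ) =
      castF (by omega) ((2 * (κ + 1)) • wedge ω (wedge (extd ω) (extd τ))) +
      castF (by omega) ((κ * (κ + 1)) • wedge (extd ω) (wedge (extd ω) τ)) := by
    refine Form.eq_of_toExt_eq (Form.isAlt_triangle _ _ _)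
      (Form.isAlt_add (Form.isAlt_castF _ (Form.isAlt_smul _ (Form.isAlt_wedge _ _)))
        (Form.isAlt_castF _ (Form.isAlt_smul _ (Form.isAlt_wedge _ _)))) ?_
    simp only [Form.toExt_triangle_triangle, Form.toExt_add, Form.toExt_castF, Form.toExt_smul,
      Form.toExt_wedge]
  refine ⟨hsq, fun hdd => Form.eq_of_toExt_eq (Form.isAlt_triangle _ _ _)
    (fun _ _ => (smul_zero _).symm) ?_⟩
  rw [Form.toExt_triangle_triangle, ← mul_assoc, ← Form.toExt_wedge, hint, ← mul_assoc,
    ← Form.toExt_wedge (extd ω) (extd ω), hdd]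
  simp [Form.toExt_zero]
end

section
/- Let ω be an integrable homogeneous 1-form of degree e with i_Rω = 0, let a ≠ e, and let τ be a homogeneous r-form of degree p = e·(r−1)/2 + a (r odd, κ = (r+1)/2). Write τ = τ_r + τ_d with τ_r = (1/p)i_R dτ and τ_d = (1/p)d i_R τ. Then ω∧dτ + κ·dω∧τ = 0 implies dω ∧ ((eκ − p)τ_r + eκ·τ_d) = 0. -/
open MvPolynomial Finset

/-- The alternating sum of a coefficient function over all permutations of its indices. -/
noncomputable def altSum {m n : ℕ} (G : Form m n) : Form m n :=
  fun f => ∑ π : Equiv.Perm (Fin n), ((Equiv.Perm.sign π : ℤˣ) : ℤ) • G (f ∘ π)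

/-- Left exterior multiplication by a `1`-form. -/
noncomputable def extMul {m r : ℕ} (ω : Form m 1) (τ : Form m r) : Form m (r + 1) :=
  fun f => ∑ i : Fin (r + 1), (-1 : ℤ) ^ (i : ℕ) • (ω (fun _ => f i) * τ (f ∘ i.succAbove))

theorem isAlt_altSum {m n : ℕ} (G : Form m n) : IsAlt (altSum G) := by
  intro f σ
  simp only [altSum, smul_sum]
  refine Fintype.sum_equiv (Equiv.mulLeft σ) _ _ fun π => ?_
  have h : f ∘ σ ∘ π = f ∘ ⇑(σ * π) := rfl
  simp only [Equiv.coe_mulLeft, Equiv.Perm.sign_mul, smul_smul, Function.comp_assoc, h]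
  rw [Units.val_mul, ← mul_assoc, ← Units.val_mul, Int.units_mul_self]
  simp

theorem IsAlt.altSum_eq {m n : ℕ} {τ : Form m n} (h : IsAlt τ) :
    altSum τ = (n.factorial : ℂ) • τ := by
  funext f
  have : ∀ π : Equiv.Perm (Fin n),
      ((Equiv.Perm.sign π : ℤˣ) : ℤ) • τ (f ∘ π) = τ f := fun π => by
    rw [h f π, smul_smul, ← Units.val_mul, Int.units_mul_self]
    simp
  simp [altSum, this, Fintype.card_perm, MvPolynomial.smul_eq_C_mul]

theorem IsAlt.add {m n : ℕ} {τ σ : Form m n} (hτ : IsAlt τ) (hσ : IsAlt σ) : IsAlt (τ + σ) := by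
  intro f π
  simp [hτ f π, hσ f π]

theorem IsAlt.smul {m n : ℕ} {τ : Form m n} (c : ℂ) (hτ : IsAlt τ) : IsAlt (c • τ) := by
  intro f π
  simp only [Pi.smul_apply, hτ f π]
  exact smul_comm _ _ _

/-- Expansion of an alternating sum along the first index. -/
theorem altSum_succ {m n : ℕ} (G : Form m (n + 1)) (f : Fin (n + 1) → Fin m) :
    altSum G f = ∑ i : Fin (n + 1), (-1 : ℤ) ^ (i : ℕ) •
      altSum (fun g => G (Fin.cons (f i) g)) (f ∘ i.succAbove) := by
  let F : Fin (n + 1) × Equiv.Perm (Fin n) → Equiv.Perm (Fin (n + 1)) :=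
    fun x => x.1.cycleRange⁻¹ * Equiv.Perm.decomposeFin.symm (0, x.2)
  have hF0 : ∀ x, F x 0 = x.1 := fun x => by simp [F, Equiv.Perm.inv_def]
  have hFs : ∀ x j, F x (Fin.succ j) = x.1.succAbove (x.2 j) := fun x j => by
    simp [F, Equiv.Perm.inv_def]
  have hF : F.Bijective := by
    rw [Fintype.bijective_iff_injective_and_card]
    refine ⟨fun x y hxy => ?_, by simp [Fintype.card_perm, Nat.factorial_succ]⟩
    obtain ⟨i, σ⟩ := x
    obtain ⟨k, ρ⟩ := y
    obtain rfl : i = k := by simpa [hF0] using congrArg (fun π => π 0) hxy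
    obtain rfl : σ = ρ := Equiv.ext fun j => by
      simpa [hFs] using congrArg (fun π => π (Fin.succ j)) hxy
    rfl
  simp only [altSum, smul_sum]
  rw [← Fintype.sum_prod_type']
  refine (Fintype.sum_bijective F hF _ _ fun x => ?_).symm
  have hcomp : f ∘ F x = Fin.cons (f x.1) ((f ∘ x.1.succAbove) ∘ x.2) := by
    funext j
    refine Fin.cases ?_ (fun j => ?_) j
    · simp [hF0]
    · simp [hFs]
  rw [hcomp, smul_smul]
  simp [F]

theorem IsAlt.cons {m n : ℕ} {τ : Form m (n + 1)} (h : IsAlt τ) (j : Fin m) :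
    IsAlt (fun g => τ (Fin.cons j g)) := by
  intro f σ
  have := h (Fin.cons j f) (Equiv.Perm.decomposeFin.symm (0, σ))
  rw [Equiv.Perm.decomposeFin.symm_sign] at this
  simp only [if_true, one_mul] at this
  rw [← this]
  refine congrArg τ (funext fun k => ?_)
  refine Fin.cases ?_ (fun k => ?_) k <;> simp

theorem IsAlt.ctr {m n : ℕ} {τ : Form m (n + 1)} (h : IsAlt τ) : IsAlt (ctr τ) := by
  intro f σ
  simp only [_root_.ctr, smul_sum]
  refine sum_congr rfl fun j _ => ?_
  rw [← mul_smul_comm]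
  exact congrArg _ (h.cons j f σ)

/-- For coefficients alternating in all but the first index, the expansion along the first index
is a multiple of an alternating sum. -/
theorem altSum_eq_sum_succAbove {m n : ℕ} {G : Form m (n + 1)}
    (hG : ∀ j, IsAlt (fun g => G (Fin.cons j g))) (f : Fin (n + 1) → Fin m) :
    altSum G f = (n.factorial : ℂ) • ∑ i : Fin (n + 1), (-1 : ℤ) ^ (i : ℕ) •
      G (Fin.cons (f i) (f ∘ i.succAbove)) := by
  rw [altSum_succ, smul_sum]
  refine sum_congr rfl fun i _ => ?_
  rw [(hG (f i)).altSum_eq, Pi.smul_apply, smul_comm]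

theorem IsAlt.extd {m n : ℕ} {τ : Form m n} (h : IsAlt τ) : IsAlt (extd τ) := by
  have key : _root_.extd τ = (n.factorial : ℂ)⁻¹ •
      altSum (fun f => pderiv (f 0) (τ (Fin.tail f))) := by
    funext f
    rw [Pi.smul_apply, altSum_eq_sum_succAbove, inv_smul_smul₀ (Nat.cast_ne_zero.mpr n.factorial_ne_zero)]
    · simp [_root_.extd]
    · intro j f σ
      simp [h f σ]
  rw [key]
  exact (isAlt_altSum _).smul _

theorem castF_wedge {m r s n : ℕ} (h : r + s = n) (τ : Form m r) (σ : Form m s) :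
    castF h (wedge τ σ) = (((r.factorial * s.factorial : ℕ) : ℂ))⁻¹ •
      altSum (fun f => τ (fun i => f (Fin.cast h (Fin.castAdd s i))) *
        σ (fun j => f (Fin.cast h (Fin.natAdd r j)))) := by
  subst h
  rfl

theorem castF_wedge_eq_extMul {m s : ℕ} (h : 1 + s = s + 1) (ω : Form m 1) {σ : Form m s}
    (hσ : IsAlt σ) : castF h (wedge ω σ) = extMul ω σ := by
  have h0 : ∀ i : Fin 1, Fin.cast h (Fin.castAdd s i) = 0 := fun i => by
    ext; simp
  have hs : ∀ j : Fin s, Fin.cast h (Fin.natAdd 1 j) = j.succ := fun j => by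
    ext; simp
  rw [castF_wedge]
  funext f
  simp only [h0, hs]
  rw [Pi.smul_apply, altSum_eq_sum_succAbove]
  · rw [Nat.factorial_one, one_mul, inv_smul_smul₀ (Nat.cast_ne_zero.mpr s.factorial_ne_zero)]
    rfl
  · intro j f π
    have := hσ f π
    simp only [Fin.cons_zero, Fin.cons_succ]
    rw [← mul_smul_comm, ← this]

theorem IsAlt.extMul {m s : ℕ} (ω : Form m 1) {σ : Form m s} (hσ : IsAlt σ) :
    IsAlt (extMul ω σ) := by
  rw [← castF_wedge_eq_extMul (add_comm 1 s) ω hσ, castF_wedge]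
  exact (isAlt_altSum _).smul _

/-- Double expansions along the first two indices are antisymmetric under exchange of these
indices. -/
theorem sum_succAbove_swap {m n : ℕ} {M : Type*} [AddCommGroup M]
    (F : Fin m → Fin m → (Fin n → Fin m) → M) (f : Fin (n + 2) → Fin m) :
    ∑ i : Fin (n + 2), ∑ k : Fin (n + 1), (-1 : ℤ) ^ ((i : ℕ) + k) •
        F (f i) (f (i.succAbove k)) ((f ∘ i.succAbove) ∘ k.succAbove) =
      -∑ i : Fin (n + 2), ∑ k : Fin (n + 1), (-1 : ℤ) ^ ((i : ℕ) + k) •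
        F (f (i.succAbove k)) (f i) ((f ∘ i.succAbove) ∘ k.succAbove) := by
  let s : Fin (n + 2) × Fin (n + 1) → Fin (n + 2) × Fin (n + 1) :=
    fun x => (x.1.succAbove x.2, x.2.predAbove x.1)
  have hs : s.Involutive := fun x => by
    simp [s, Fin.succAbove_succAbove_predAbove, Fin.predAbove_predAbove_succAbove]
  rw [← Fintype.sum_prod_type', ← Fintype.sum_prod_type', ← sum_neg_distrib]
  refine Fintype.sum_bijective s hs.bijective _ _ fun x => ?_
  have hc : (f ∘ (x.1.succAbove x.2).succAbove) ∘ (x.2.predAbove x.1).succAbove =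
      (f ∘ x.1.succAbove) ∘ x.2.succAbove := by
    funext k
    simp [Fin.succAbove_succAbove_succAbove_predAbove]
  simp only [s, Fin.neg_one_pow_succAbove_add_predAbove, Fin.succAbove_succAbove_predAbove, hc,
    neg_smul, neg_neg]

theorem pderiv_comm {m : ℕ} (a b : Fin m) (q : MvPolynomial (Fin m) ℂ) :
    pderiv a (pderiv b q) = pderiv b (pderiv a q) := by
  induction q using MvPolynomial.induction_on with
  | C c => simp
  | add q₁ q₂ h₁ h₂ => simp [h₁, h₂]
  | mul_X q i h =>
    have hX : ∀ c d : Fin m, pderiv (R := ℂ) c (pderiv d (X i)) = 0 := fun c d => by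
      rw [pderiv_X, Pi.single_apply]
      split_ifs <;> simp
    simp only [Derivation.leibniz, map_add, smul_eq_mul, h, hX]
    ring

theorem extd_extd {m n : ℕ} (τ : Form m n) : extd (extd τ) = 0 := by
  funext f
  have h : extd (extd τ) f = ∑ i : Fin (n + 2), ∑ k : Fin (n + 1), (-1 : ℤ) ^ ((i : ℕ) + k) •
      pderiv (f i) (pderiv (f (i.succAbove k)) (τ ((f ∘ i.succAbove) ∘ k.succAbove))) := by
    simp only [extd, map_sum, map_zsmul, smul_sum, smul_smul, pow_add, Function.comp_apply]
  have hswap := sum_succAbove_swap (fun a b g => pderiv a (pderiv b (τ g))) f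
  rw [h]
  refine self_eq_neg.mp (hswap.trans (congrArg Neg.neg ?_))
  refine sum_congr rfl fun i _ => sum_congr rfl fun k _ => ?_
  rw [pderiv_comm]

theorem extd_add {m n : ℕ} (τ σ : Form m n) : extd (τ + σ) = extd τ + extd σ := by
  funext f
  simp [extd, sum_add_distrib]

theorem extd_smul {m n : ℕ} (c : ℂ) (τ : Form m n) : extd (c • τ) = c • extd τ := by
  funext f
  simp only [extd, Pi.smul_apply, smul_sum]
  refine sum_congr rfl fun i _ => ?_
  rw [Derivation.map_smul, smul_comm]

theorem ctr_smul {m n : ℕ} (c : ℂ) (τ : Form m (n + 1)) : ctr (c • τ) = c • ctr τ := by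
  funext f
  simp [ctr, smul_sum]

theorem extMul_add {m n : ℕ} (ω : Form m 1) (τ σ : Form m n) :
    extMul ω (τ + σ) = extMul ω τ + extMul ω σ := by
  funext f
  simp [extMul, mul_add, sum_add_distrib]

theorem extMul_smul {m n : ℕ} (ω : Form m 1) (c : ℂ) (τ : Form m n) :
    extMul ω (c • τ) = c • extMul ω τ := by
  funext f
  simp only [extMul, Pi.smul_apply, smul_sum, mul_smul_comm]
  exact sum_congr rfl fun i _ => smul_comm _ _ _

theorem cons_comp_succ_succAbove {m n : ℕ} (j : Fin m) (f : Fin (n + 1) → Fin m)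
    (k : Fin (n + 1)) :
    (Fin.cons j f : Fin (n + 2) → Fin m) ∘ k.succ.succAbove = Fin.cons j (f ∘ k.succAbove) := by
  funext l
  refine Fin.cases ?_ (fun l => ?_) l <;> simp

theorem ctr_extMul {m n : ℕ} {ω : Form m 1} (hω : ctr ω = 0) (τ : Form m (n + 1)) :
    ctr (extMul ω τ) = -extMul ω (ctr τ) := by
  funext f
  have h0 : ∑ j : Fin m, X j * ω (fun _ => j) = 0 := by
    refine Eq.trans ?_ (congrFun hω Fin.elim0)
    refine sum_congr rfl fun j _ => ?_
    congr 2
    funext i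
    rw [Subsingleton.elim i 0, Fin.cons_zero]
  have hcomp : ∀ j, (Fin.cons j f : Fin (n + 2) → Fin m) ∘ Fin.succ = f := fun j => by
    funext l
    simp
  simp only [ctr, extMul, Fin.sum_univ_succ (n := n + 1), mul_add, sum_add_distrib, Pi.neg_apply,
    Fin.cons_zero, Fin.cons_succ, cons_comp_succ_succAbove, Fin.val_zero, pow_zero, one_smul,
    Fin.succAbove_zero, hcomp]
  simp only [← mul_assoc, ← sum_mul, h0, zero_mul, zero_add, mul_sum, smul_sum]
  rw [sum_comm, ← sum_neg_distrib]
  refine sum_congr rfl fun k _ => ?_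
  rw [← sum_neg_distrib]
  refine sum_congr rfl fun j _ => ?_
  rw [Fin.val_succ, pow_succ, mul_neg_one, neg_smul, mul_neg, mul_smul_comm, mul_left_comm, mul_assoc]

/-- Cartan's formula for the radial field, on homogeneous alternating forms. -/
theorem ctr_extd_add_extd_ctr {m n d : ℕ} {τ : Form m (n + 1)} (hτ : IsAlt τ)
    (hd : ∀ f, (τ f).IsHomogeneous d) :
    ctr (extd τ) + extd (ctr τ) = ((d + (n + 1) : ℕ) : ℂ) • τ := by
  funext f
  have hcomp : ∀ j, (Fin.cons j f : Fin (n + 2) → Fin m) ∘ Fin.succ = f := fun j => by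
    funext l
    simp
  have hcyc : ∀ k : Fin (n + 1),
      (-1 : ℤ) ^ (k : ℕ) • τ (Fin.cons (f k) (f ∘ k.succAbove)) = τ f := fun k => by
    have hk : Fin.cons (f k) (f ∘ k.succAbove) = f ∘ ⇑(k.cycleRange⁻¹) := by
      funext l
      refine Fin.cases ?_ (fun l => ?_) l <;> simp [Equiv.Perm.inv_def]
    rw [hk, hτ, smul_smul]
    simp [← mul_pow]
  have hctr : ctr (extd τ) f = (d : ℂ) • τ f -
      ∑ k : Fin (n + 1), (-1 : ℤ) ^ (k : ℕ) •
        ∑ j : Fin m, X j * pderiv (f k) (τ (Fin.cons j (f ∘ k.succAbove))) := by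
    have := (hd f).sum_X_mul_pderiv
    simp only [ctr, extd, Fin.sum_univ_succ (n := n + 1), mul_add, sum_add_distrib,
      Fin.cons_zero, Fin.cons_succ, cons_comp_succ_succAbove, Fin.val_zero, pow_zero, one_smul,
      Fin.succAbove_zero, hcomp, this]
    rw [sub_eq_add_neg, Nat.cast_smul_eq_nsmul]
    congr 1
    simp only [mul_sum, smul_sum]
    rw [sum_comm, ← sum_neg_distrib]
    refine sum_congr rfl fun k _ => ?_
    rw [← sum_neg_distrib]
    refine sum_congr rfl fun j _ => ?_
    rw [Fin.val_succ, pow_succ, mul_neg_one, neg_smul, mul_neg, mul_smul_comm]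
  have hext : extd (ctr τ) f = ((n + 1 : ℕ) : ℂ) • τ f +
      ∑ k : Fin (n + 1), (-1 : ℤ) ^ (k : ℕ) •
        ∑ j : Fin m, X j * pderiv (f k) (τ (Fin.cons j (f ∘ k.succAbove))) := by
    have hsum : ((n + 1 : ℕ) : ℂ) • τ f =
        ∑ k : Fin (n + 1), (-1 : ℤ) ^ (k : ℕ) • τ (Fin.cons (f k) (f ∘ k.succAbove)) := by
      simp only [hcyc, sum_const, card_univ, Fintype.card_fin]
      rw [Nat.cast_smul_eq_nsmul]
    rw [hsum, ← sum_add_distrib]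
    refine sum_congr rfl fun k _ => ?_
    rw [← smul_add]
    congr 1
    simp [ctr, pderiv_X, sum_add_distrib, Pi.single_apply, add_comm]
  rw [Pi.add_apply, hctr, hext, Pi.smul_apply, Nat.cast_add d, add_smul, sub_add_add_cancel]

theorem isHomogeneous_extMul {m n d d' : ℕ} {ω : Form m 1} {τ : Form m n}
    (hω : ∀ f, (ω f).IsHomogeneous d) (hτ : ∀ f, (τ f).IsHomogeneous d')
    (f : Fin (n + 1) → Fin m) : (extMul ω τ f).IsHomogeneous (d + d') := by
  refine IsHomogeneous.sum _ _ _ fun i _ => ?_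
  exact (homogeneousSubmodule (Fin m) ℂ (d + d')).toAddSubgroup.zsmul_mem ((hω _).mul (hτ _)) _

/-- The Leibniz rule for the product of a `1`-form with an alternating form. -/
theorem castF_wedge_extd {m s : ℕ} (h : 1 + 1 + s = s + 2) (ω : Form m 1) {τ : Form m s}
    (hτ : IsAlt τ) :
    castF h (wedge (extd ω) τ) = extd (extMul ω τ) + extMul ω (extd τ) := by
  let G : Form m (s + 2) := fun f =>
    pderiv (f 0) (ω fun _ => f 1) * τ (fun j => f j.succ.succ)
  have h0 : Fin.cast h (Fin.castAdd s 0) = 0 := by ext; simp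
  have h1 : Fin.cast h (Fin.castAdd s 1) = 1 := by ext; simp
  have hs : ∀ j : Fin s, Fin.cast h (Fin.natAdd (1 + 1) j) = j.succ.succ := fun j => by
    ext
    simp
  have hG : (fun f : Fin (s + 2) → Fin m =>
      extd ω (fun i => f (Fin.cast h (Fin.castAdd s i))) *
        τ (fun j => f (Fin.cast h (Fin.natAdd (1 + 1) j)))) =
      fun f => G f - G (f ∘ Equiv.swap 0 1) := by
    funext f
    have hsw : ∀ j : Fin s, Equiv.swap (0 : Fin (s + 2)) 1 j.succ.succ = j.succ.succ := fun j =>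
      Equiv.swap_apply_of_ne_of_ne (by simp [Fin.ext_iff]) (by simp [Fin.ext_iff])
    have ha : (fun i : Fin (1 + 1) => f (Fin.cast h (Fin.castAdd s i))) ∘ Fin.succAbove 0 =
        fun _ => f 1 := by
      funext i
      rw [Subsingleton.elim i 0, ← h1]
      rfl
    have hb : (fun i : Fin (1 + 1) => f (Fin.cast h (Fin.castAdd s i))) ∘ Fin.succAbove 1 =
        fun _ => f 0 := by
      funext i
      rw [Subsingleton.elim i 0, ← h0]
      rfl
    simp only [extd, hs, G]
    rw [Fin.sum_univ_two, ha, hb, h0, h1]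
    simp [hsw]
    ring
  have hswap : altSum (fun f => G f - G (f ∘ Equiv.swap 0 1)) = (2 : ℂ) • altSum G := by
    funext f
    have : ∑ π : Equiv.Perm (Fin (s + 2)), ((Equiv.Perm.sign π : ℤˣ) : ℤ) •
        G ((f ∘ π) ∘ Equiv.swap 0 1) = -altSum G f := by
      rw [altSum, ← sum_neg_distrib]
      refine Fintype.sum_equiv (Equiv.mulRight (Equiv.swap 0 1)) _ _ fun π => ?_
      simp [Equiv.Perm.sign_mul, Function.comp_assoc]
    simp only [altSum, smul_sub, sum_sub_distrib, this]
    simp only [altSum, Pi.smul_apply, two_smul, sub_neg_eq_add]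
  have hexp : ∀ f, altSum G f = (s.factorial : ℂ) • ∑ i : Fin (s + 2), ∑ k : Fin (s + 1),
      (-1 : ℤ) ^ ((i : ℕ) + k) • (pderiv (f i) (ω fun _ => f (i.succAbove k)) *
        τ ((f ∘ i.succAbove) ∘ k.succAbove)) := fun f => by
    rw [altSum_succ, smul_sum]
    refine sum_congr rfl fun i _ => ?_
    rw [altSum_eq_sum_succAbove]
    · rw [smul_comm, smul_sum]
      congr 1
      refine sum_congr rfl fun k _ => ?_
      rw [smul_smul, pow_add]
      rfl
    · intro j g π
      simp only [G]
      rw [← mul_smul_comm, ← hτ]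
      rfl
  have hleib : ∀ f, (extd (extMul ω τ) + extMul ω (extd τ)) f =
      ∑ i : Fin (s + 2), ∑ k : Fin (s + 1),
      (-1 : ℤ) ^ ((i : ℕ) + k) • (pderiv (f i) (ω fun _ => f (i.succAbove k)) *
        τ ((f ∘ i.succAbove) ∘ k.succAbove)) := fun f => by
    have hd : extd (extMul ω τ) f = ∑ i : Fin (s + 2), ∑ k : Fin (s + 1),
        (-1 : ℤ) ^ ((i : ℕ) + k) • (pderiv (f i) (ω fun _ => f (i.succAbove k)) *
          τ ((f ∘ i.succAbove) ∘ k.succAbove)) +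
        ∑ i : Fin (s + 2), ∑ k : Fin (s + 1), (-1 : ℤ) ^ ((i : ℕ) + k) •
          (ω (fun _ => f (i.succAbove k)) *
            pderiv (f i) (τ ((f ∘ i.succAbove) ∘ k.succAbove))) := by
      simp only [extd, extMul, map_sum, map_zsmul, Derivation.leibniz, smul_sum, smul_smul,
        ← pow_add, ← sum_add_distrib, ← smul_add, smul_eq_mul, Function.comp_apply]
      refine sum_congr rfl fun i _ => sum_congr rfl fun k _ => ?_
      rw [add_comm (ω _ * _), mul_comm (τ _)]
    have he : extMul ω (extd τ) f = ∑ i : Fin (s + 2), ∑ k : Fin (s + 1),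
        (-1 : ℤ) ^ ((i : ℕ) + k) • (ω (fun _ => f i) *
          pderiv (f (i.succAbove k)) (τ ((f ∘ i.succAbove) ∘ k.succAbove))) := by
      simp only [extd, extMul, mul_sum, mul_smul_comm, smul_sum, smul_smul, ← pow_add,
        Function.comp_apply]
    rw [Pi.add_apply, hd, he,
      sum_succAbove_swap (fun a b g => ω (fun _ => a) * pderiv b (τ g)) f, add_neg_cancel_right]
  have hfac : ((Nat.factorial (1 + 1) * s.factorial : ℕ) : ℂ)⁻¹ * 2 * (s.factorial : ℂ) = 1 := by
    have : (s.factorial : ℂ) ≠ 0 := Nat.cast_ne_zero.mpr s.factorial_ne_zero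
    simp only [Nat.cast_mul, Nat.factorial_two, Nat.reduceAdd, Nat.cast_ofNat]
    field_simp
  rw [castF_wedge, hG, hswap]
  funext f
  rw [hleib, Pi.smul_apply, Pi.smul_apply, hexp, smul_smul, smul_smul, hfac, one_smul]

theorem castF_eq_zero {m r s : ℕ} (h : r = s) {τ : Form m r} (hτ : castF h τ = 0) : τ = 0 := by
  subst h
  exact hτ

/-- the map `φ(τ) = (eκ−p)·τ_r + eκ·τ_d` sends the kernel of
`ω△(−)` into the kernel of `dω∧(−)`, for `τ` a homogeneous `r`-form of degree
`p = e(r−1)/2 + a` (i.e. `2p + e = er + 2a`), `r` odd, `κ = (r+1)/2`, `a ≠ e`. -/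
theorem triangle_kernel_to_linear_kernel {m a e p r : ℕ}
    (hrodd : Odd r) (hrp : r ≤ p) (he : 1 ≤ e) (hane : a ≠ e)
    (hp : 2 * p + e = e * r + 2 * a)
    (ω : Form m 1) (hω : IsHomog 1 e ω) (hR : ctr ω = 0)
    (hint : wedge ω (extd ω) = 0)
    (τ : Form m r) (hτa : IsAlt τ) (hτ : IsHomog r p τ)
    (κ : ℂ) (hκ : κ = ((r : ℂ) + 1) / 2)
    (H : triangle ω κ τ = 0) :
    wedge (extd ω)
      (((e : ℂ) * κ - (p : ℂ)) • (((p : ℂ))⁻¹ • ctr (extd τ)) +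
        ((e : ℂ) * κ) • (((p : ℂ))⁻¹ • dIR τ)) = 0 := by
  obtain ⟨n, rfl⟩ : ∃ n, r = n + 1 := ⟨r - 1, by have := hrodd.pos; omega⟩
  have hp0 : (p : ℂ) ≠ 0 := by
    rw [Nat.cast_ne_zero]
    omega
  have hκ1 : κ + 1 ≠ 0 := by
    rw [hκ, div_add_one two_ne_zero]
    refine div_ne_zero ?_ two_ne_zero
    exact_mod_cast Nat.succ_ne_zero (n + 1 + 1 + 1)
  have hCτ : ctr (extd τ) + extd (ctr τ) = (p : ℂ) • τ := by
    have := ctr_extd_add_extd_ctr hτa hτ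
    rwa [Nat.sub_add_cancel hrp] at this
  have hCE : ctr (extd (extMul ω τ)) + extd (ctr (extMul ω τ)) =
      ((e : ℂ) + p) • extMul ω τ := by
    have := ctr_extd_add_extd_ctr (hτa.extMul ω) (isHomogeneous_extMul hω hτ)
    rwa [show e - 1 + (p - (n + 1)) + (n + 1 + 1) = e + p by omega, Nat.cast_add] at this
  have hdcdτ : extd (ctr (extd τ)) = (p : ℂ) • extd τ := by
    simpa [extd_add, extd_extd, extd_smul] using congrArg extd hCτ
  have hdcdE : extd (ctr (extd (extMul ω τ))) = ((e : ℂ) + p) • extd (extMul ω τ) := by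
    simpa [extd_add, extd_extd, extd_smul] using congrArg extd hCE
  have hH : (κ + 1) • extMul ω (extd τ) = -κ • extd (extMul ω τ) := by
    rw [triangle, castF_wedge_eq_extMul _ ω hτa.extd, castF_wedge_extd _ ω hτa] at H
    linear_combination (norm := module) H
  have hdE : (κ + 1) • extd (extMul ω (ctr (extd τ))) =
      (κ * (e + p)) • extd (extMul ω τ) := by
    have h1 : extd (ctr (extMul ω (extd τ))) = (-1 : ℂ) • extd (extMul ω (ctr (extd τ))) := by
      rw [ctr_extMul hR, ← extd_smul, neg_one_smul]
    have h2 := congrArg (fun σ => extd (ctr σ)) hH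
    simp only [ctr_smul, extd_smul, hdcdE, h1] at h2
    linear_combination (norm := module) -h2
  have hφ : ((e : ℂ) * κ - (p : ℂ)) • (((p : ℂ))⁻¹ • ctr (extd τ)) +
        ((e : ℂ) * κ) • (((p : ℂ))⁻¹ • dIR τ) =
      ((e : ℂ) * κ) • τ + (-1 : ℂ) • ctr (extd τ) := by
    have hB : dIR τ = (p : ℂ) • τ - ctr (extd τ) := eq_sub_of_add_eq' hCτ
    rw [hB]
    match_scalars <;> field_simp
    ring
  rw [hφ]
  apply castF_eq_zero (show 1 + 1 + (n + 1) = n + 1 + 2 by omega)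
  rw [castF_wedge_extd _ ω ((hτa.smul _).add (hτa.extd.ctr.smul _))]
  simp only [extMul_add, extMul_smul, extd_add, extd_smul, hdcdτ]
  refine (smul_eq_zero_iff_right hκ1).mp ?_
  linear_combination (norm := module) (e * κ - p : ℂ) • hH - hdE
end
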